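/- (Reflection-algebra representation from the quantum monodromy matrix.) Assume η and β are such that all sinh-denominators appearing are nonzero. Let K⁺(λ) be a c-number (2×2 complex matrix-valued) solution of the right reflection equation with the XXZ R-matrix. Define the 2×2 matrix-valued function 𝒯⁺(λ), with entries operators on (ℂ²)^{⊗N}, by 𝒯⁺(λ)^t = T̃^{QTM}(−λ) · K⁺(λ) · σ^y · T̃^{QTM t}(λ+η) · σ^y, where the transpose t and the conjugation by σ^y act on the 2×2 auxiliary indices. Then 𝒯⁺(λ) satisfies the right reflection equation with the XXZ R-matrix (for all λ, μ for which the expressions are defined). -/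

import Mathlib

/- STATEMENT 18: A reflection-algebra representation from the quantum monodromy matrix. -/

noncomputable section

open Complex Matrix Filter

/-- `b(λ) = sinh(λ)/sinh(λ+η)`. -/
def bf (η lam : ℂ) : ℂ := Complex.sinh lam / Complex.sinh (lam + η)

/-- `c(λ) = sinh(η)/sinh(λ+η)`. -/
def cf (η lam : ℂ) : ℂ := Complex.sinh η / Complex.sinh (lam + η)

/-- Pauli matrix σʸ. -/
def sigy : Matrix (Fin 2) (Fin 2) ℂ := !![0, -Complex.I; Complex.I, 0]

/-- `e_n^{αβ}`: the elementary 2×2 matrix with entry 1 in row α, column β, at site n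
of (ℂ²)^{⊗N}. -/
def Ee {N : ℕ} (n : Fin N) (α β : Fin 2) :
    Matrix (Fin N → Fin 2) (Fin N → Fin 2) ℂ :=
  Matrix.of fun s s' => if s n = α ∧ s' = Function.update s n β then 1 else 0

/-- A one-site operator acting on the site n of (ℂ²)^{⊗N}. -/
def emb1c {N : ℕ} (n : Fin N) (M : Matrix (Fin 2) (Fin 2) ℂ) :
    Matrix (Fin N → Fin 2) (Fin N → Fin 2) ℂ :=
  Matrix.of fun s s' => M (s n) (s' n) * (if s = Function.update s' n (s n) then 1 else 0)

/-- The XXZ L-matrix `L_n(λ,μ)`, a 2×2 matrix of operators on (ℂ²)^{⊗N}. -/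
def Lmat {N : ℕ} (η : ℂ) (n : Fin N) (lam mu : ℂ) :
    Matrix (Fin 2) (Fin 2) (Matrix (Fin N → Fin 2) (Fin N → Fin 2) ℂ) :=
  !![Ee n 0 0 + bf η (lam - mu) • Ee n 1 1, cf η (lam - mu) • Ee n 1 0;
     cf η (lam - mu) • Ee n 0 1, bf η (lam - mu) • Ee n 0 0 + Ee n 1 1]

/-- The XXZ L-matrix `L̃_n(μ,λ)`. -/
def Ltil {N : ℕ} (η : ℂ) (n : Fin N) (mu lam : ℂ) :
    Matrix (Fin 2) (Fin 2) (Matrix (Fin N → Fin 2) (Fin N → Fin 2) ℂ) :=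
  !![Ee n 0 0 + bf η (mu - lam) • Ee n 1 1, cf η (mu - lam) • Ee n 0 1;
     cf η (mu - lam) • Ee n 1 0, bf η (mu - lam) • Ee n 0 0 + Ee n 1 1]

/-- The quantum monodromy matrix
`T^{QTM}(λ) = L̃_N(−β/N,λ)L_{N−1}(λ,β/N)···L̃_2(−β/N,λ)L_1(λ,β/N)`
(sites are numbered 0,…,N−1 here, so the original site j corresponds to index j−1 and
the even original sites are the odd indices). -/
def Tqtm (η : ℂ) (N : ℕ) (β : ℂ) (lam : ℂ) :
    Matrix (Fin 2) (Fin 2) (Matrix (Fin N → Fin 2) (Fin N → Fin 2) ℂ) :=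
  ((List.ofFn fun j : Fin N =>
    if (j : ℕ) % 2 = 1 then Ltil η j (-β / N) lam else Lmat η j lam (β / N)).reverse).prod

/-- `a(λ) = b(−β/N−λ)^{N/2}`. -/
def aQ (η : ℂ) (N : ℕ) (β : ℂ) (lam : ℂ) : ℂ := bf η (-β / N - lam) ^ (N / 2)

/-- The inhomogeneities: `ξ_j = η − β/N` for even original j (odd index), `ξ_j = β/N`
for odd original j (even index). -/
def xiQ (η : ℂ) (N : ℕ) (β : ℂ) (j : Fin N) : ℂ :=
  if (j : ℕ) % 2 = 1 then η - β / N else β / N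

/-- The XXZ R-matrix on ℂ² ⊗ ℂ². -/
def Rxxz (η lam : ℂ) : Matrix (Fin 2 × Fin 2) (Fin 2 × Fin 2) ℂ :=
  Matrix.of fun p q =>
    if p.1 = q.1 ∧ p.2 = q.2 then (if p.1 = p.2 then 1 else bf η lam)
    else if p.1 = q.2 ∧ p.2 = q.1 then cf η lam else 0

/-- A complex matrix on ℂ² ⊗ ℂ² viewed as a matrix with entries in an algebra A. -/
def liftR2 {A : Type} [Semiring A] [Algebra ℂ A]
    (R : Matrix (Fin 2 × Fin 2) (Fin 2 × Fin 2) ℂ) :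
    Matrix (Fin 2 × Fin 2) (Fin 2 × Fin 2) A :=
  R.map (algebraMap ℂ A)

/-- A 2×2 matrix of operators with its 2×2 indices placed in the first ℂ² factor. -/
def emb1q {A : Type} [Zero A] (M : Matrix (Fin 2) (Fin 2) A) :
    Matrix (Fin 2 × Fin 2) (Fin 2 × Fin 2) A :=
  Matrix.of fun p q => if p.2 = q.2 then M p.1 q.1 else 0

/-- 2×2 indices placed in the second ℂ² factor. -/
def emb2q {A : Type} [Zero A] (M : Matrix (Fin 2) (Fin 2) A) :
    Matrix (Fin 2 × Fin 2) (Fin 2 × Fin 2) A :=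
  Matrix.of fun p q => if p.1 = q.1 then M p.2 q.2 else 0

/-- σʸ acting on the 2×2 auxiliary indices. -/
def sigyOp (N : ℕ) : Matrix (Fin 2) (Fin 2) (Matrix (Fin N → Fin 2) (Fin N → Fin 2) ℂ) :=
  sigy.map (algebraMap ℂ (Matrix (Fin N → Fin 2) (Fin N → Fin 2) ℂ))

/-- The rescaled quantum monodromy matrix `T̃^{QTM}(λ) = T^{QTM}(λ)/a(λ)`. -/
def TtilQ (η : ℂ) (N : ℕ) (β : ℂ) (lam : ℂ) :
    Matrix (Fin 2) (Fin 2) (Matrix (Fin N → Fin 2) (Fin N → Fin 2) ℂ) :=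
  (aQ η N β lam)⁻¹ • Tqtm η N β lam

/-- All sinh-denominators appearing in `T̃^{QTM}(x)` are nonzero (and `a(x) ≠ 0`). -/
def DefinedAt (η : ℂ) (N : ℕ) (β : ℂ) (x : ℂ) : Prop :=
  Complex.sinh (-β / N - x + η) ≠ 0 ∧ Complex.sinh (x - β / N + η) ≠ 0 ∧
    Complex.sinh (-β / N - x) ≠ 0

/-- `𝒯⁺(λ)`, defined by `𝒯⁺(λ)ᵗ = T̃^{QTM}(−λ)·K⁺(λ)·σ^y·T̃^{QTM t}(λ+η)·σ^y`. -/
def TauPlus (η : ℂ) (N : ℕ) (β : ℂ) (Kp : ℂ → Matrix (Fin 2) (Fin 2) ℂ) (lam : ℂ) :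
    Matrix (Fin 2) (Fin 2) (Matrix (Fin N → Fin 2) (Fin N → Fin 2) ℂ) :=
  (TtilQ η N β (-lam) *
      (Kp lam).map (algebraMap ℂ (Matrix (Fin N → Fin 2) (Fin N → Fin 2) ℂ)) *
      sigyOp N * (TtilQ η N β (lam + η))ᵀ * sigyOp N)ᵀ

/-! ### The two embeddings of `2 × 2` matrices into `ℂ² ⊗ ℂ²` -/

section Embeddings

variable {A : Type} [Ring A]

lemma emb1q_mul (M M' : Matrix (Fin 2) (Fin 2) A) : emb1q (M * M') = emb1q M * emb1q M' := by
  ext ⟨a, b⟩ ⟨c, d⟩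
  by_cases h : b = d <;> simp [emb1q, Matrix.mul_apply, Fintype.sum_prod_type, h]

lemma emb2q_mul (M M' : Matrix (Fin 2) (Fin 2) A) : emb2q (M * M') = emb2q M * emb2q M' := by
  ext ⟨a, b⟩ ⟨c, d⟩
  by_cases h : a = c <;> simp [emb2q, Matrix.mul_apply, Fintype.sum_prod_type_right, h]

lemma emb1q_one : emb1q (1 : Matrix (Fin 2) (Fin 2) A) = 1 := by
  ext ⟨a, b⟩ ⟨c, d⟩
  by_cases h : b = d <;> simp [emb1q, Matrix.one_apply, h]

lemma emb2q_one : emb2q (1 : Matrix (Fin 2) (Fin 2) A) = 1 := by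
  ext ⟨a, b⟩ ⟨c, d⟩
  by_cases h : a = c <;> simp [emb2q, Matrix.one_apply, h]

lemma emb1q_list_prod (l : List (Matrix (Fin 2) (Fin 2) A)) :
    emb1q l.prod = (l.map emb1q).prod := by
  induction l with
  | nil => simp [emb1q_one]
  | cons M l ih => simp [emb1q_mul, ih]

lemma emb2q_list_prod (l : List (Matrix (Fin 2) (Fin 2) A)) :
    emb2q l.prod = (l.map emb2q).prod := by
  induction l with
  | nil => simp [emb2q_one]
  | cons M l ih => simp [emb2q_mul, ih]

lemma emb1q_mul_emb2q_apply (M M' : Matrix (Fin 2) (Fin 2) A) (p q : Fin 2 × Fin 2) :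
    (emb1q M * emb2q M') p q = M p.1 q.1 * M' p.2 q.2 := by
  simp [emb1q, emb2q, Matrix.mul_apply, Fintype.sum_prod_type]

lemma emb2q_mul_emb1q_apply (M M' : Matrix (Fin 2) (Fin 2) A) (p q : Fin 2 × Fin 2) :
    (emb2q M' * emb1q M) p q = M' p.2 q.2 * M p.1 q.1 := by
  simp [emb1q, emb2q, Matrix.mul_apply, Fintype.sum_prod_type]

lemma transpose_emb1q_mul_emb2q (M M' : Matrix (Fin 2) (Fin 2) A) :
    (emb1q M * emb2q M')ᵀ = emb1q Mᵀ * emb2q M'ᵀ := by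
  ext p q
  simp [emb1q_mul_emb2q_apply]

lemma transpose_emb2q_mul_emb1q (M M' : Matrix (Fin 2) (Fin 2) A) :
    (emb2q M' * emb1q M)ᵀ = emb2q M'ᵀ * emb1q Mᵀ := by
  ext p q
  simp [emb2q_mul_emb1q_apply]

/-- The partial transpose in the first tensor factor. -/
def transpose₁ {B : Type} (X : Matrix (Fin 2 × Fin 2) (Fin 2 × Fin 2) B) :
    Matrix (Fin 2 × Fin 2) (Fin 2 × Fin 2) B :=
  Matrix.of fun p q => X (q.1, p.2) (p.1, q.2)

lemma commute_emb1q_emb2q {M M' : Matrix (Fin 2) (Fin 2) A}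
    (h : ∀ a b c d, Commute (M a b) (M' c d)) : Commute (emb1q M) (emb2q M') := by
  ext p q
  rw [emb1q_mul_emb2q_apply, emb2q_mul_emb1q_apply]
  exact h _ _ _ _

/-- Exchange of the two tensor factors. -/
def swap₁₂ {B : Type} (X : Matrix (Fin 2 × Fin 2) (Fin 2 × Fin 2) B) :
    Matrix (Fin 2 × Fin 2) (Fin 2 × Fin 2) B :=
  X.submatrix Prod.swap Prod.swap

lemma swap₁₂_mul (X Y : Matrix (Fin 2 × Fin 2) (Fin 2 × Fin 2) A) :
    swap₁₂ (X * Y) = swap₁₂ X * swap₁₂ Y :=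
  (Matrix.submatrix_mul_equiv X Y Prod.swap (Equiv.prodComm _ _) Prod.swap).symm

lemma swap₁₂_emb1q (M : Matrix (Fin 2) (Fin 2) A) : swap₁₂ (emb1q M) = emb2q M := rfl

lemma swap₁₂_emb2q (M : Matrix (Fin 2) (Fin 2) A) : swap₁₂ (emb2q M) = emb1q M := rfl

variable [Algebra ℂ A]

lemma emb1q_smul (k : ℂ) (M : Matrix (Fin 2) (Fin 2) A) : emb1q (k • M) = k • emb1q M := by
  ext ⟨a, b⟩ ⟨c, d⟩
  by_cases h : b = d <;> simp [emb1q, h]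

lemma emb2q_smul (k : ℂ) (M : Matrix (Fin 2) (Fin 2) A) : emb2q (k • M) = k • emb2q M := by
  ext ⟨a, b⟩ ⟨c, d⟩
  by_cases h : a = c <;> simp [emb2q, h]

lemma commute_emb1q_map (K : Matrix (Fin 2) (Fin 2) ℂ) (M : Matrix (Fin 2) (Fin 2) A) :
    Commute (emb1q (K.map (algebraMap ℂ A))) (emb2q M) :=
  commute_emb1q_emb2q fun _ _ _ _ => Algebra.commutes _ _

lemma commute_emb2q_map (K : Matrix (Fin 2) (Fin 2) ℂ) (M : Matrix (Fin 2) (Fin 2) A) :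
    Commute (emb1q M) (emb2q (K.map (algebraMap ℂ A))) :=
  commute_emb1q_emb2q fun _ _ _ _ => (Algebra.commutes _ _).symm

lemma liftR2_mul (X Y : Matrix (Fin 2 × Fin 2) (Fin 2 × Fin 2) ℂ) :
    liftR2 (A := A) (X * Y) = liftR2 X * liftR2 Y :=
  Matrix.map_mul

lemma liftR2_smul (k : ℂ) (X : Matrix (Fin 2 × Fin 2) (Fin 2 × Fin 2) ℂ) :
    liftR2 (A := A) (k • X) = k • liftR2 X := by
  ext p q
  change algebraMap ℂ A (k * X p q) = k • algebraMap ℂ A (X p q)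
  rw [map_mul, ← Algebra.smul_def]

lemma liftR2_emb1q (K : Matrix (Fin 2) (Fin 2) ℂ) :
    liftR2 (A := A) (emb1q K) = emb1q (K.map (algebraMap ℂ A)) := by
  ext ⟨a, b⟩ ⟨c, d⟩
  by_cases h : b = d <;> simp [emb1q, liftR2, h]

lemma liftR2_emb2q (K : Matrix (Fin 2) (Fin 2) ℂ) :
    liftR2 (A := A) (emb2q K) = emb2q (K.map (algebraMap ℂ A)) := by
  ext ⟨a, b⟩ ⟨c, d⟩
  by_cases h : a = c <;> simp [emb2q, liftR2, h]

lemma transpose_liftR2_mul (R : Matrix (Fin 2 × Fin 2) (Fin 2 × Fin 2) ℂ)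
    (X : Matrix (Fin 2 × Fin 2) (Fin 2 × Fin 2) A) :
    (liftR2 R * X)ᵀ = Xᵀ * liftR2 Rᵀ := by
  ext p q
  simp [Matrix.mul_apply, liftR2, Algebra.commutes]

lemma transpose_mul_liftR2 (R : Matrix (Fin 2 × Fin 2) (Fin 2 × Fin 2) ℂ)
    (X : Matrix (Fin 2 × Fin 2) (Fin 2 × Fin 2) A) :
    (X * liftR2 R)ᵀ = liftR2 Rᵀ * Xᵀ := by
  ext p q
  simp [Matrix.mul_apply, liftR2, Algebra.commutes]

lemma mul_algebraMap (x : A) (k : ℂ) : x * algebraMap ℂ A k = k • x := by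
  rw [Algebra.smul_def, Algebra.commutes]

lemma transpose₁_liftR2_mul_emb (R : Matrix (Fin 2 × Fin 2) (Fin 2 × Fin 2) ℂ)
    (M M' : Matrix (Fin 2) (Fin 2) A) :
    transpose₁ (liftR2 R * (emb1q M * emb2q M')) =
      emb1q Mᵀ * liftR2 (transpose₁ R) * emb2q M' := by
  ext ⟨a, b⟩ ⟨c, d⟩
  rw [transpose₁, Matrix.of_apply, Matrix.mul_apply]
  simp only [emb1q_mul_emb2q_apply]
  simp [Matrix.mul_apply, emb1q, emb2q, liftR2, transpose₁, Fintype.sum_prod_type,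
    ← Algebra.smul_def, mul_algebraMap, add_mul]
  abel

lemma transpose₁_emb_mul_liftR2 (R : Matrix (Fin 2 × Fin 2) (Fin 2 × Fin 2) ℂ)
    (M M' : Matrix (Fin 2) (Fin 2) A) :
    transpose₁ (emb2q M' * emb1q M * liftR2 R) =
      emb2q M' * liftR2 (transpose₁ R) * emb1q Mᵀ := by
  ext ⟨a, b⟩ ⟨c, d⟩
  rw [transpose₁, Matrix.of_apply, Matrix.mul_apply]
  simp only [emb2q_mul_emb1q_apply]
  simp [Matrix.mul_apply, emb1q, emb2q, liftR2, transpose₁, Fintype.sum_prod_type,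
    mul_algebraMap, add_mul]

end Embeddings

/-! ### The R-matrix -/

/-- The XXZ R-matrix with the denominator `sinh (λ + η)` cleared. -/
def Rnum (η lam : ℂ) : Matrix (Fin 2 × Fin 2) (Fin 2 × Fin 2) ℂ :=
  Matrix.of fun p q =>
    if p.1 = q.1 ∧ p.2 = q.2 then
      (if p.1 = p.2 then Complex.sinh (lam + η) else Complex.sinh lam)
    else if p.1 = q.2 ∧ p.2 = q.1 then Complex.sinh η else 0

lemma Rxxz_eq_smul_Rnum {η lam : ℂ} (h : Complex.sinh (lam + η) ≠ 0) :
    Rxxz η lam = (Complex.sinh (lam + η))⁻¹ • Rnum η lam := by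
  ext ⟨a, b⟩ ⟨c, d⟩
  fin_cases a <;> fin_cases b <;> fin_cases c <;> fin_cases d <;>
    simp [Rxxz, Rnum, bf, cf, h] <;> ring

lemma transpose_Rnum (η lam : ℂ) : (Rnum η lam)ᵀ = Rnum η lam := by
  ext ⟨a, b⟩ ⟨c, d⟩
  fin_cases a <;> fin_cases b <;> fin_cases c <;> fin_cases d <;> simp [Rnum]

lemma transpose_Rxxz (η lam : ℂ) : (Rxxz η lam)ᵀ = Rxxz η lam := by
  ext ⟨a, b⟩ ⟨c, d⟩
  fin_cases a <;> fin_cases b <;> fin_cases c <;> fin_cases d <;> simp [Rxxz]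

lemma swap₁₂_liftR2_Rnum {A : Type} [Ring A] [Algebra ℂ A] (η lam : ℂ) :
    swap₁₂ (liftR2 (A := A) (Rnum η lam)) = liftR2 (Rnum η lam) := by
  ext ⟨a, b⟩ ⟨c, d⟩
  fin_cases a <;> fin_cases b <;> fin_cases c <;> fin_cases d <;> simp [Rnum, liftR2, swap₁₂]

/-- Crossing symmetry of the R-matrix. -/
lemma Rnum_crossing (η lam : ℂ) :
    emb1q sigy * transpose₁ (Rnum η lam) * emb1q sigy = -Rnum η (-lam - η) := by
  ext ⟨a, b⟩ ⟨c, d⟩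
  fin_cases a <;> fin_cases b <;> fin_cases c <;> fin_cases d <;>
    simp [Rnum, transpose₁, emb1q, sigy, Matrix.mul_apply, Fintype.sum_prod_type,
      ← Complex.sinh_neg] <;> ring_nf <;> simp

lemma sigy_mul_sigy : sigy * sigy = 1 := by
  ext a b
  fin_cases a <;> fin_cases b <;> simp [sigy]

lemma Rnum_sigy_sigy (η lam : ℂ) :
    Rnum η lam * (emb1q sigy * emb2q sigy) = emb1q sigy * emb2q sigy * Rnum η lam := by
  ext ⟨a, b⟩ ⟨c, d⟩
  rw [Matrix.mul_apply, Matrix.mul_apply]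
  simp only [emb1q_mul_emb2q_apply]
  fin_cases a <;> fin_cases b <;> fin_cases c <;> fin_cases d <;>
    simp [Rnum, sigy, Fintype.sum_prod_type]

/-! ### Exchange relations -/

section Exchange

variable {A : Type} [Ring A] [Algebra ℂ A]

/-- The exchange relation `R M₁ M'₂ = M'₂ M₁ R`. -/
def Exchange (R : Matrix (Fin 2 × Fin 2) (Fin 2 × Fin 2) ℂ) (M M' : Matrix (Fin 2) (Fin 2) A) :
    Prop :=
  liftR2 R * (emb1q M * emb2q M') = emb2q M' * emb1q M * liftR2 R

lemma Exchange.smul {R : Matrix (Fin 2 × Fin 2) (Fin 2 × Fin 2) ℂ}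
    {M M' : Matrix (Fin 2) (Fin 2) A} (h : Exchange R M M') (k k' : ℂ) :
    Exchange R (k • M) (k' • M') := by
  unfold Exchange at *
  simp only [emb1q_smul, emb2q_smul, smul_mul_assoc, mul_smul_comm, h]
  rw [smul_comm]

lemma mul_list_prod_mul_list_prod {ι S : Type*} [Monoid S] (r : S) (f g : ι → S) (l : List ι)
    (hl : l.Nodup) (hr : ∀ i ∈ l, r * (f i * g i) = g i * f i * r)
    (hc : ∀ i j, i ≠ j → Commute (f i) (g j)) :
    r * ((l.map f).prod * (l.map g).prod) = (l.map g).prod * (l.map f).prod * r := by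
  induction l with
  | nil => simp
  | cons i l ih =>
    rw [List.nodup_cons] at hl
    have ih' := ih hl.2 fun j hj => hr j (List.mem_cons_of_mem _ hj)
    have hi := hr i List.mem_cons_self
    have hne : ∀ j ∈ l, j ≠ i := fun j hj h => hl.1 (h ▸ hj)
    have h₁ : Commute (l.map f).prod (g i) := by
      refine Commute.list_prod_left _ _ fun x hx => ?_
      obtain ⟨j, hj, rfl⟩ := List.mem_map.1 hx
      exact hc j i (hne j hj)
    have h₂ : Commute (f i) (l.map g).prod := by
      refine Commute.list_prod_right _ _ fun x hx => ?_
      obtain ⟨j, hj, rfl⟩ := List.mem_map.1 hx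
      exact hc i j (hne j hj).symm
    simp only [List.map_cons, List.prod_cons]
    generalize (l.map f).prod = F at *
    generalize (l.map g).prod = G at *
    calc r * (f i * F * (g i * G)) = r * (f i * (F * g i) * G) := by simp only [mul_assoc]
      _ = r * (f i * g i) * (F * G) := by rw [h₁.eq]; simp only [mul_assoc]
      _ = g i * f i * (r * (F * G)) := by rw [hi]; simp only [mul_assoc]
      _ = g i * (f i * G) * F * r := by rw [ih']; simp only [mul_assoc]
      _ = g i * G * (f i * F) * r := by rw [h₂.eq]; simp only [mul_assoc]

lemma Exchange.list_prod {ι : Type*} {R : Matrix (Fin 2 × Fin 2) (Fin 2 × Fin 2) ℂ}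
    {f g : ι → Matrix (Fin 2) (Fin 2) A} {l : List ι} (hl : l.Nodup)
    (h : ∀ i ∈ l, Exchange R (f i) (g i))
    (hc : ∀ i j, i ≠ j → ∀ a b c d, Commute (f i a b) (g j c d)) :
    Exchange R (l.map f).prod (l.map g).prod := by
  unfold Exchange
  rw [emb1q_list_prod, emb2q_list_prod, List.map_map, List.map_map]
  exact mul_list_prod_mul_list_prod _ _ _ l hl h fun i j hij => commute_emb1q_emb2q (hc i j hij)

/-- `σʸ Mᵗ σʸ`, up to a scalar function the inverse of a quantum monodromy matrix. -/
def sigyConj (M : Matrix (Fin 2) (Fin 2) A) : Matrix (Fin 2) (Fin 2) A :=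
  sigy.map (algebraMap ℂ A) * Mᵀ * sigy.map (algebraMap ℂ A)

lemma map_sigy_mul_map_sigy : sigy.map (algebraMap ℂ A) * sigy.map (algebraMap ℂ A) = 1 := by
  rw [← Matrix.map_mul, sigy_mul_sigy, Matrix.map_one _ (map_zero _) (map_one _)]

lemma Exchange.crossing {η u : ℂ} {M M' : Matrix (Fin 2) (Fin 2) A}
    (h : Exchange (Rnum η u) M M') :
    emb1q (sigyConj M) * liftR2 (Rnum η (-u - η)) * emb2q M' =
      emb2q M' * liftR2 (Rnum η (-u - η)) * emb1q (sigyConj M) := by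
  have ht := congrArg transpose₁ h
  rw [transpose₁_liftR2_mul_emb, transpose₁_emb_mul_liftR2] at ht
  have hR : liftR2 (A := A) (Rnum η (-u - η)) =
      -(emb1q (sigy.map (algebraMap ℂ A)) * liftR2 (transpose₁ (Rnum η u)) *
        emb1q (sigy.map (algebraMap ℂ A))) := by
    rw [← liftR2_emb1q, ← liftR2_mul, ← liftR2_mul, Rnum_crossing]
    ext p q
    simp [liftR2]
  have hs : emb1q (sigy.map (algebraMap ℂ A)) * emb1q (sigy.map (algebraMap ℂ A)) = 1 := by
    rw [← emb1q_mul, map_sigy_mul_map_sigy, emb1q_one]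
  have hc := commute_emb1q_map (A := A) sigy M'
  rw [hR, sigyConj, emb1q_mul, emb1q_mul]
  generalize emb1q (sigy.map (algebraMap ℂ A)) = s at *
  generalize emb1q Mᵀ = m at *
  generalize emb2q M' = m' at *
  generalize liftR2 (A := A) (transpose₁ (Rnum η u)) = r at *
  simp only [mul_neg, neg_mul, neg_inj]
  calc s * m * s * (s * r * s) * m' = s * m * (s * s) * r * (s * m') := by
        simp only [mul_assoc]
    _ = s * (m * r * m') * s := by rw [hs, hc.eq]; simp only [mul_assoc, one_mul]
    _ = (s * m') * r * m * s := by rw [ht]; simp only [mul_assoc]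
    _ = m' * s * r * (s * s) * m * s := by rw [hc.eq, hs, mul_one]
    _ = m' * (s * r * s) * (s * m * s) := by simp only [mul_assoc]

lemma Exchange.sigyConj_sigyConj {η u : ℂ} {M M' : Matrix (Fin 2) (Fin 2) A}
    (h : Exchange (Rnum η u) M M') : Exchange (Rnum η u) (sigyConj M') (sigyConj M) := by
  have ht := congrArg (fun X => (swap₁₂ X)ᵀ) h
  simp only [swap₁₂_mul, swap₁₂_emb1q, swap₁₂_emb2q, swap₁₂_liftR2_Rnum] at ht
  rw [transpose_liftR2_mul, transpose_mul_liftR2, transpose_Rnum, transpose_emb1q_mul_emb2q,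
    transpose_emb2q_mul_emb1q] at ht
  have hR := congrArg (liftR2 (A := A)) (Rnum_sigy_sigy η u)
  simp only [liftR2_mul, liftR2_emb1q, liftR2_emb2q] at hR
  unfold Exchange
  have c₁ := commute_emb1q_map (A := A) sigy
  have c₂ := fun M : Matrix (Fin 2) (Fin 2) A => commute_emb2q_map sigy M
  have c₃ := c₁ (sigy.map (algebraMap ℂ A))
  have c₄ := c₁ Mᵀ
  have c₅ := c₂ M'ᵀ
  simp only [sigyConj, emb1q_mul, emb2q_mul]
  clear c₁ c₂ h
  generalize emb1q (sigy.map (algebraMap ℂ A)) = s at *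
  generalize emb2q (sigy.map (algebraMap ℂ A)) = s' at *
  generalize emb1q M'ᵀ = m' at *
  generalize emb2q Mᵀ = m at *
  generalize liftR2 (A := A) (Rnum η u) = r at *
  have e₁ : s * m' * s * (s' * m * s') = s * s' * (m' * m) * (s * s') := by
    calc s * m' * s * (s' * m * s') = s * m' * (s * s') * m * s' := by simp only [mul_assoc]
      _ = s * (m' * s') * (s * m) * s' := by rw [c₃.eq]; simp only [mul_assoc]
      _ = _ := by rw [c₄.eq, c₅.eq]; simp only [mul_assoc]
  have e₂ : s' * m * s' * (s * m' * s) = s * s' * (m * m') * (s * s') := by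
    calc s' * m * s' * (s * m' * s) = s' * m * (s' * s) * m' * s := by simp only [mul_assoc]
      _ = s' * (m * s) * (s' * m') * s := by rw [← c₃.eq]; simp only [mul_assoc]
      _ = (s' * s) * (m * m') * (s' * s) := by rw [← c₄.eq, ← c₅.eq]; simp only [mul_assoc]
      _ = _ := by rw [← c₃.eq]
  rw [e₁, e₂]
  calc r * (s * s' * (m' * m) * (s * s')) = r * (s * s') * (m' * m) * (s * s') := by
        simp only [mul_assoc]
    _ = s * s' * (r * (m' * m)) * (s * s') := by rw [hR]; simp only [mul_assoc]
    _ = s * s' * (m * m') * (r * (s * s')) := by rw [← ht]; simp only [mul_assoc]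
    _ = _ := by rw [hR]; simp only [mul_assoc]

end Exchange

/-! ### The L-matrices -/

lemma Ee_mul_apply {N : ℕ} (n : Fin N) (a b : Fin 2)
    (X : Matrix (Fin N → Fin 2) (Fin N → Fin 2) ℂ) (s t : Fin N → Fin 2) :
    (Ee n a b * X) s t = if s n = a then X (Function.update s n b) t else 0 := by
  by_cases h : s n = a <;> simp [Ee, Matrix.mul_apply, h]

lemma Ee_mul {N : ℕ} (n : Fin N) (a b c d : Fin 2) :
    Ee n a b * Ee n c d = if b = c then Ee n a d else 0 := by
  ext s t
  rw [Ee_mul_apply]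
  by_cases ha : s n = a <;> by_cases h : b = c <;> simp [Ee, ha, h]

lemma commute_Ee {N : ℕ} {m n : Fin N} (h : m ≠ n) (a b c d : Fin 2) :
    Commute (Ee m a b) (Ee n c d) := by
  ext s t
  rw [Ee_mul_apply, Ee_mul_apply]
  by_cases h₁ : s m = a <;> by_cases h₂ : s n = c <;>
    simp [Ee, h, h.symm, h₁, h₂, Function.update_comm h]

/-- `Lmat` with the denominator cleared, as a function of the difference of its arguments. -/
def Lnum {N : ℕ} (η : ℂ) (n : Fin N) (u : ℂ) :
    Matrix (Fin 2) (Fin 2) (Matrix (Fin N → Fin 2) (Fin N → Fin 2) ℂ) :=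
  !![Complex.sinh (u + η) • Ee n 0 0 + Complex.sinh u • Ee n 1 1, Complex.sinh η • Ee n 1 0;
     Complex.sinh η • Ee n 0 1, Complex.sinh u • Ee n 0 0 + Complex.sinh (u + η) • Ee n 1 1]

/-- `Ltil` with the denominator cleared, as a function of the difference of its arguments. -/
def LtilNum {N : ℕ} (η : ℂ) (n : Fin N) (u : ℂ) :
    Matrix (Fin 2) (Fin 2) (Matrix (Fin N → Fin 2) (Fin N → Fin 2) ℂ) :=
  !![Complex.sinh (u + η) • Ee n 0 0 + Complex.sinh u • Ee n 1 1, Complex.sinh η • Ee n 0 1;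
     Complex.sinh η • Ee n 1 0, Complex.sinh u • Ee n 0 0 + Complex.sinh (u + η) • Ee n 1 1]

lemma Lmat_eq_smul {N : ℕ} {η : ℂ} (n : Fin N) {lam mu : ℂ}
    (h : Complex.sinh (lam - mu + η) ≠ 0) :
    Lmat η n lam mu = (Complex.sinh (lam - mu + η))⁻¹ • Lnum η n (lam - mu) := by
  ext a b i j
  fin_cases a <;> fin_cases b <;>
    simp [Lmat, Lnum, bf, cf] <;> field_simp

lemma Ltil_eq_smul {N : ℕ} {η : ℂ} (n : Fin N) {mu lam : ℂ}
    (h : Complex.sinh (mu - lam + η) ≠ 0) :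
    Ltil η n mu lam = (Complex.sinh (mu - lam + η))⁻¹ • LtilNum η n (mu - lam) := by
  ext a b i j
  fin_cases a <;> fin_cases b <;>
    simp [Ltil, LtilNum, bf, cf] <;> field_simp

set_option maxHeartbeats 1600000 in
lemma exchange_Lnum {N : ℕ} (η : ℂ) (n : Fin N) (u v : ℂ) :
    Exchange (Rnum η (u - v)) (Lnum η n u) (Lnum η n v) := by
  unfold Exchange
  ext p q : 2
  rw [Matrix.mul_apply, Matrix.mul_apply]
  simp only [emb1q_mul_emb2q_apply, emb2q_mul_emb1q_apply]
  obtain ⟨a, b⟩ := p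
  obtain ⟨c, d⟩ := q
  fin_cases a <;> fin_cases b <;> fin_cases c <;> fin_cases d <;>
    simp [Rnum, Lnum, liftR2, Fintype.sum_prod_type, ← Algebra.smul_def, mul_algebraMap,
      mul_add, add_mul, Ee_mul] <;>
    simp only [Complex.sinh, sub_eq_add_neg, neg_add, neg_neg, Complex.exp_add,
      Complex.exp_neg] <;>
    field_simp <;> ring

set_option maxHeartbeats 1600000 in
lemma exchange_LtilNum {N : ℕ} (η : ℂ) (n : Fin N) (u v : ℂ) :
    Exchange (Rnum η (u - v)) (LtilNum η n (-u)) (LtilNum η n (-v)) := by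
  unfold Exchange
  ext p q : 2
  rw [Matrix.mul_apply, Matrix.mul_apply]
  simp only [emb1q_mul_emb2q_apply, emb2q_mul_emb1q_apply]
  obtain ⟨a, b⟩ := p
  obtain ⟨c, d⟩ := q
  fin_cases a <;> fin_cases b <;> fin_cases c <;> fin_cases d <;>
    simp [Rnum, LtilNum, liftR2, Fintype.sum_prod_type, ← Algebra.smul_def, mul_algebraMap,
      mul_add, add_mul, Ee_mul] <;>
    simp only [Complex.sinh, sub_eq_add_neg, neg_add, neg_neg, Complex.exp_add,
      Complex.exp_neg] <;>
    field_simp <;> ring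

/-! ### The quantum monodromy matrix -/

/-- The factor of the quantum monodromy matrix acting on site `j`. -/
def qtmFactor (η : ℂ) {N : ℕ} (β lam : ℂ) (j : Fin N) :
    Matrix (Fin 2) (Fin 2) (Matrix (Fin N → Fin 2) (Fin N → Fin 2) ℂ) :=
  if (j : ℕ) % 2 = 1 then Ltil η j (-β / N) lam else Lmat η j lam (β / N)

lemma Tqtm_eq_prod (η : ℂ) (N : ℕ) (β lam : ℂ) :
    Tqtm η N β lam = ((List.finRange N).reverse.map (qtmFactor η β lam)).prod := by
  rw [List.map_reverse, ← List.ofFn_eq_map]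
  rfl

lemma commute_qtmFactor_of_forall (η : ℂ) {N : ℕ} (β x : ℂ) (j : Fin N)
    {X : Matrix (Fin N → Fin 2) (Fin N → Fin 2) ℂ} (hX : ∀ c d, X * Ee j c d = Ee j c d * X)
    (c d : Fin 2) : Commute X (qtmFactor η β x j c d) := by
  unfold qtmFactor Commute SemiconjBy
  split_ifs <;> fin_cases c <;> fin_cases d <;> simp [Ltil, Lmat, mul_add, add_mul, hX]

lemma commute_qtmFactor (η : ℂ) {N : ℕ} (β x y : ℂ) {i j : Fin N} (hij : i ≠ j)
    (a b c d : Fin 2) : Commute (qtmFactor η β x i a b) (qtmFactor η β y j c d) :=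
  commute_qtmFactor_of_forall η β y j (fun c d =>
    (commute_qtmFactor_of_forall η β x i (fun a b => commute_Ee hij.symm c d a b) a b).symm) c d

lemma exchange_qtmFactor {η : ℂ} {N : ℕ} {β x y : ℂ} (hx : DefinedAt η N β x)
    (hy : DefinedAt η N β y) (j : Fin N) :
    Exchange (Rnum η (x - y)) (qtmFactor η β x j) (qtmFactor η β y j) := by
  unfold qtmFactor
  split_ifs
  · rw [Ltil_eq_smul j hx.1, Ltil_eq_smul j hy.1]
    have h := exchange_LtilNum η j (x - -β / N) (y - -β / N)
    rw [sub_sub_sub_cancel_right, neg_sub, neg_sub] at h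
    exact h.smul _ _
  · rw [Lmat_eq_smul j hx.2.1, Lmat_eq_smul j hy.2.1]
    have h := exchange_Lnum η j (x - β / N) (y - β / N)
    rw [sub_sub_sub_cancel_right] at h
    exact h.smul _ _

lemma exchange_TtilQ {η : ℂ} {N : ℕ} {β x y : ℂ} (hx : DefinedAt η N β x)
    (hy : DefinedAt η N β y) :
    Exchange (Rnum η (x - y)) (TtilQ η N β x) (TtilQ η N β y) := by
  refine Exchange.smul ?_ _ _
  rw [Tqtm_eq_prod, Tqtm_eq_prod]
  exact Exchange.list_prod (List.nodup_reverse.2 (List.nodup_finRange N))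
    (fun j _ => exchange_qtmFactor hx hy j) fun _ _ hij => commute_qtmFactor η β x y hij

/-! ### Dressing of a c-number solution -/

lemma reflection_dressing {S : Type*} [Semigroup S] {R R' A₁ A₂ K₁ K₂ H₁ H₂ : S}
    (hA : R * (A₁ * A₂) = A₂ * A₁ * R) (hH : R * (H₁ * H₂) = H₂ * H₁ * R)
    (hHA : H₁ * R' * A₂ = A₂ * R' * H₁) (hAH : H₂ * R' * A₁ = A₁ * R' * H₂)
    (hK : R * K₁ * R' * K₂ = K₂ * R' * K₁ * R) (hKA : Commute K₁ A₂) (hHK : Commute H₁ K₂)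
    (hAK : Commute A₁ K₂) (hKH : Commute K₁ H₂) :
    R * (A₁ * K₁ * H₁) * R' * (A₂ * K₂ * H₂) = A₂ * K₂ * H₂ * R' * (A₁ * K₁ * H₁) * R := by
  calc R * (A₁ * K₁ * H₁) * R' * (A₂ * K₂ * H₂)
      = R * A₁ * K₁ * (H₁ * R' * A₂) * K₂ * H₂ := by simp only [mul_assoc]
    _ = R * A₁ * (K₁ * A₂) * R' * (H₁ * K₂) * H₂ := by rw [hHA]; simp only [mul_assoc]
    _ = R * (A₁ * A₂) * K₁ * R' * K₂ * (H₁ * H₂) := by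
      rw [hKA.eq, hHK.eq]; simp only [mul_assoc]
    _ = A₂ * A₁ * (R * K₁ * R' * K₂) * (H₁ * H₂) := by rw [hA]; simp only [mul_assoc]
    _ = A₂ * A₁ * K₂ * R' * K₁ * (R * (H₁ * H₂)) := by rw [hK]; simp only [mul_assoc]
    _ = A₂ * (A₁ * K₂) * R' * (K₁ * H₂) * H₁ * R := by rw [hH]; simp only [mul_assoc]
    _ = A₂ * K₂ * (A₁ * R' * H₂) * K₁ * H₁ * R := by
      rw [hAK.eq, hKH.eq]; simp only [mul_assoc]
    _ = A₂ * K₂ * H₂ * R' * (A₁ * K₁ * H₁) * R := by rw [← hAH]; simp only [mul_assoc]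

lemma transpose_emb1q {A : Type} [Ring A] (M : Matrix (Fin 2) (Fin 2) A) :
    (emb1q M)ᵀ = emb1q Mᵀ := by
  ext p q
  simp [emb1q, eq_comm]

lemma transpose_emb2q {A : Type} [Ring A] (M : Matrix (Fin 2) (Fin 2) A) :
    (emb2q M)ᵀ = emb2q Mᵀ := by
  ext p q
  simp [emb2q, eq_comm]

/-- For c-number matrices the right reflection equation is invariant under transposition. -/
lemma reflection_transpose {η u v : ℂ} {K K' : Matrix (Fin 2) (Fin 2) ℂ}
    (h : Rxxz η u * emb1q Kᵀ * Rxxz η v * emb2q K'ᵀ =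
      emb2q K'ᵀ * Rxxz η v * emb1q Kᵀ * Rxxz η u) :
    Rxxz η u * emb1q K * Rxxz η v * emb2q K' = emb2q K' * Rxxz η v * emb1q K * Rxxz η u := by
  have ht := congrArg Matrix.transpose h
  simp only [Matrix.transpose_mul, transpose_Rxxz, transpose_emb1q, transpose_emb2q,
    Matrix.transpose_transpose] at ht
  simpa only [mul_assoc] using ht.symm

/-- If `K⁺(λ)` is a c-number solution of the right reflection equation with the XXZ
R-matrix, then `𝒯⁺(λ)` with `𝒯⁺(λ)ᵗ = T̃^{QTM}(−λ)K⁺(λ)σ^y T̃^{QTM t}(λ+η)σ^y` also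
satisfies the right reflection equation (wherever the expressions are defined). -/
theorem qtm_right_reflection_representation (η : ℂ) (hη : Complex.sinh η ≠ 0)
    (N : ℕ) (hN2 : 2 ≤ N) (hNeven : Even N) (β : ℂ)
    (Kp : ℂ → Matrix (Fin 2) (Fin 2) ℂ)
    (hKp : ∀ lam mu : ℂ, Complex.sinh (-lam + mu + η) ≠ 0 →
      Complex.sinh (-lam - mu - η) ≠ 0 →
      Rxxz η (-lam + mu) * emb1q ((Kp lam)ᵀ) * Rxxz η (-lam - mu - 2 * η) *
          emb2q ((Kp mu)ᵀ) =
        emb2q ((Kp mu)ᵀ) * Rxxz η (-lam - mu - 2 * η) * emb1q ((Kp lam)ᵀ) *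
          Rxxz η (-lam + mu)) :
    ∀ lam mu : ℂ,
      DefinedAt η N β (-lam) → DefinedAt η N β (lam + η) →
      DefinedAt η N β (-mu) → DefinedAt η N β (mu + η) →
      Complex.sinh (-lam + mu + η) ≠ 0 → Complex.sinh (-lam - mu - η) ≠ 0 →
      liftR2 (Rxxz η (-lam + mu)) * emb1q ((TauPlus η N β Kp lam)ᵀ) *
          liftR2 (Rxxz η (-lam - mu - 2 * η)) * emb2q ((TauPlus η N β Kp mu)ᵀ) =
        emb2q ((TauPlus η N β Kp mu)ᵀ) * liftR2 (Rxxz η (-lam - mu - 2 * η)) *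
          emb1q ((TauPlus η N β Kp lam)ᵀ) * liftR2 (Rxxz η (-lam + mu)) := by
  intro lam mu hl hl' hm hm' hR hR'
  have hR'' : Complex.sinh (-lam - mu - 2 * η + η) ≠ 0 := by
    convert hR' using 2
    ring
  have hK := congrArg (liftR2 (A := Matrix (Fin N → Fin 2) (Fin N → Fin 2) ℂ))
    (reflection_transpose (hKp lam mu hR hR'))
  simp only [liftR2_mul, liftR2_emb1q, liftR2_emb2q] at hK
  have hA := exchange_TtilQ hl hm
  have hH := (exchange_TtilQ hm' hl').sigyConj_sigyConj
  have hHA := (exchange_TtilQ hl' hm).crossing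
  have hAH := congrArg swap₁₂ (exchange_TtilQ hm' hl).crossing
  simp only [swap₁₂_mul, swap₁₂_emb1q, swap₁₂_emb2q, swap₁₂_liftR2_Rnum] at hAH
  rw [show -lam - -mu = -lam + mu by ring] at hA
  rw [show mu + η - (lam + η) = -lam + mu by ring] at hH
  rw [show -(lam + η - -mu) - η = -lam - mu - 2 * η by ring] at hHA
  rw [show -(mu + η - -lam) - η = -lam - mu - 2 * η by ring] at hAH
  unfold Exchange at hA hH
  have hTau : ∀ x, (TauPlus η N β Kp x)ᵀ = TtilQ η N β (-x) *
      (Kp x).map (algebraMap ℂ (Matrix (Fin N → Fin 2) (Fin N → Fin 2) ℂ)) *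
      sigyConj (TtilQ η N β (x + η)) := fun x => by
    simp only [TauPlus, Matrix.transpose_transpose, sigyConj, sigyOp, mul_assoc]
  rw [hTau, hTau]
  simp only [emb1q_mul, emb2q_mul]
  refine reflection_dressing ?_ ?_ ?_ ?_ hK (commute_emb1q_map _ _) (commute_emb2q_map _ _)
    (commute_emb2q_map _ _) (commute_emb1q_map _ _)
  · rw [Rxxz_eq_smul_Rnum hR, liftR2_smul, smul_mul_assoc, mul_smul_comm, hA]
  · rw [Rxxz_eq_smul_Rnum hR, liftR2_smul, smul_mul_assoc, mul_smul_comm, hH]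
  · rw [Rxxz_eq_smul_Rnum hR'', liftR2_smul]
    simp only [smul_mul_assoc, mul_smul_comm, hHA]
  · rw [Rxxz_eq_smul_Rnum hR'', liftR2_smul]
    simp only [smul_mul_assoc, mul_smul_comm, hAH]

end
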